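/- Let W be an (α,m,N)-source over {0,1}^n. Let H : {0,1}^m × 𝒮 → {0,1}^ν be a universal hash family, where ν = ξ + t, and suppose ξ ≤ α + 2 − 2·log₂(2ℓ/σ) − t and ℓ·m < N. Let R be uniform over {0,1}^ξ, Z uniform over 𝒮, and A_1,…,A_ℓ independent uniformly random subsets of {1,…,n} of cardinality m, with R, Z, A_1,…,A_ℓ, W mutually independent. Set p_i = (0^t | R) ⊕ H(W[A_i], Z) for i = 1,…,ℓ. Then Δ((R, p_1,…,p_ℓ, Z, A_1,…,A_ℓ); (U_ξ, p_1,…,p_ℓ, Z, A_1,…,A_ℓ)) ≤ σ, where U_ξ is uniform over {0,1}^ξ independent of (p_1,…,p_ℓ, Z, A_1,…,A_ℓ). -/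

import Mathlib

noncomputable section

/-- Statistical distance between two PMFs on a finite type. -/
def statDist {T : Type*} [Fintype T] (p q : PMF T) : ℝ :=
  (1 / 2) * ∑ v : T, |(p v).toReal - (q v).toReal|

/-- Average conditional min-entropy of a joint distribution on X × Y. -/
def avgCondMinEntropy {X Y : Type*} [Fintype X] [Fintype Y] (μ : PMF (X × Y)) : ℝ :=
  - Real.logb 2 (∑ y : Y, ⨆ x : X, (μ (x, y)).toReal)

/-- Universal hash family: for all `x ≠ y`, `Pr_S[h(x,S) = h(y,S)] ≤ 1/|Y|`. -/
def UniversalHash {X S Y : Type*} [Fintype S] [Fintype Y] [DecidableEq Y]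
    (h : X → S → Y) : Prop :=
  ∀ x y : X, x ≠ y →
    ((Finset.univ.filter fun s => h x s = h y s).card : ℝ) / (Fintype.card S) ≤
      1 / (Fintype.card Y)

lemma mSub_nonempty {α : Type*} [Fintype α] [DecidableEq α] {m : ℕ}
    (h : m ≤ Fintype.card α) : Nonempty {A : Finset α // A.card = m} := by
  obtain ⟨t, -, ht⟩ := Finset.exists_subset_card_eq
    (show m ≤ (Finset.univ : Finset α).card by simpa using h)
  exact ⟨⟨t, ht⟩⟩

/-- `k` independent uniformly random `m`-subsets. -/
def uniformSubsets (α : Type*) [Fintype α] [DecidableEq α] (m k : ℕ)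
    (h : m ≤ Fintype.card α) : PMF (Fin k → {A : Finset α // A.card = m}) :=
  haveI : Nonempty {A : Finset α // A.card = m} := mSub_nonempty h
  PMF.uniformOfFintype _

/-- A uniformly random `m`-subset. -/
def uniformSubset (α : Type*) [Fintype α] [DecidableEq α] (m : ℕ)
    (h : m ≤ Fintype.card α) : PMF {A : Finset α // A.card = m} :=
  haveI : Nonempty {A : Finset α // A.card = m} := mSub_nonempty h
  PMF.uniformOfFintype _

/-- The masked substring `w[A]`. -/
def subsample {α : Type*} [DecidableEq α] (w : α → Bool) (A : Finset α) :
    α → Option Bool :=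
  fun i => if i ∈ A then some (w i) else none

/-- The substring of `w` indexed by the `m`-subset `A` (in increasing order of positions). -/
def sampleBits {n m : ℕ} (w : Fin n → Bool) (A : {s : Finset (Fin n) // s.card = m}) :
    Fin m → Bool :=
  fun i => w (A.1.orderIsoOfFin A.2 i).1

/-- `(α,m,N)`-source over `{0,1}^n`. -/
def IsAlphaSource (n : ℕ) (Wd : PMF (Fin n → Bool)) (α : ℝ) (m N : ℕ)
    (hm : m ≤ n) (hN : N ≤ n) : Prop :=
  α ≤ avgCondMinEntropy (do
    let w ← Wd
    let A ← uniformSubset (Fin n) m (by simpa using hm)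
    let B ← uniformSubset (Fin n) N (by simpa using hN)
    return (subsample w A.1, (subsample w B.1, A, B)))


section Reusability

open Finset

section PMFReal

variable {α β γ : Type*}

lemma PMF.toReal_bind_apply [Fintype α] (p : PMF α) (f : α → PMF β) (b : β) :
    ((p.bind f) b).toReal = ∑ a, (p a).toReal * (f a b).toReal := by
  rw [PMF.bind_apply, tsum_fintype, ENNReal.toReal_sum]
  · simp only [ENNReal.toReal_mul]
  · exact fun a _ => ENNReal.mul_ne_top (p.apply_ne_top a) ((f a).apply_ne_top b)

lemma PMF.toReal_pure_apply [DecidableEq α] (a b : α) :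
    (PMF.pure a b).toReal = if a = b then 1 else 0 := by
  rw [PMF.pure_apply]
  by_cases h : a = b
  · simp [h]
  · simp [h, Ne.symm h]

lemma PMF.sum_toReal_apply [Fintype α] (p : PMF α) : ∑ a, (p a).toReal = 1 := by
  rw [← ENNReal.toReal_sum fun a _ => p.apply_ne_top a, ← tsum_fintype (L := .unconditional _), p.tsum_coe]
  simp

lemma PMF.toReal_uniformOfFintype_apply [Fintype α] [Nonempty α] (a : α) :
    (PMF.uniformOfFintype α a).toReal = (Fintype.card α : ℝ)⁻¹ := by
  simp

lemma PMF.uniformOfFintype_bind_equiv [Fintype α] [Nonempty α] (e : α ≃ α) (f : α → PMF β) :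
    (PMF.uniformOfFintype α).bind (fun a => f (e a)) = (PMF.uniformOfFintype α).bind f := by
  ext b
  simp only [PMF.bind_apply, PMF.uniformOfFintype_apply]
  exact e.tsum_eq (fun a => (Fintype.card α : ENNReal)⁻¹ * f a b)

lemma statDist_comm [Fintype α] (p q : PMF α) : statDist p q = statDist q p := by
  simp only [statDist, abs_sub_comm]

lemma statDist_triangle [Fintype α] (p q r : PMF α) :
    statDist p r ≤ statDist p q + statDist q r := by
  simp only [statDist]
  rw [← mul_add, ← sum_add_distrib]
  gcongr
  exact abs_sub_le _ _ _

/-- Data processing: a common randomized post-processing does not increase the distance. -/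
lemma statDist_bind_le [Fintype α] [Fintype β] (p q : PMF α) (f : α → PMF β) :
    statDist (p.bind f) (q.bind f) ≤ statDist p q := by
  simp only [statDist, PMF.toReal_bind_apply]
  gcongr 1 / 2 * ?_
  calc ∑ b, |∑ a, (p a).toReal * (f a b).toReal - ∑ a, (q a).toReal * (f a b).toReal|
      ≤ ∑ b, ∑ a, |(p a).toReal - (q a).toReal| * (f a b).toReal := by
        refine sum_le_sum fun b _ => ?_
        rw [← sum_sub_distrib]
        refine (abs_sum_le_sum_abs _ _).trans_eq (sum_congr rfl fun a _ => ?_)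
        rw [← sub_mul, abs_mul, abs_of_nonneg (ENNReal.toReal_nonneg (a := f a b))]
    _ = ∑ a, |(p a).toReal - (q a).toReal| := by
        rw [sum_comm]
        refine sum_congr rfl fun a _ => ?_
        rw [← mul_sum, PMF.sum_toReal_apply, mul_one]

/-- Convexity: the distance of two mixtures with the same weights is at most the average
distance. -/
lemma statDist_bind_bind_le [Fintype α] [Fintype β] (p : PMF α) (f g : α → PMF β) :
    statDist (p.bind f) (p.bind g) ≤ ∑ a, (p a).toReal * statDist (f a) (g a) := by
  simp only [statDist, PMF.toReal_bind_apply]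
  calc 1 / 2 * ∑ b, |∑ a, (p a).toReal * (f a b).toReal - ∑ a, (p a).toReal * (g a b).toReal|
      ≤ 1 / 2 * ∑ b, ∑ a, (p a).toReal * |(f a b).toReal - (g a b).toReal| := by
        gcongr with b
        rw [← sum_sub_distrib]
        refine (abs_sum_le_sum_abs _ _).trans_eq (sum_congr rfl fun a _ => ?_)
        rw [← mul_sub, abs_mul, abs_of_nonneg (ENNReal.toReal_nonneg (a := p a))]
    _ = _ := by
        rw [sum_comm, mul_sum]
        refine sum_congr rfl fun a _ => ?_
        rw [← mul_sum]
        ring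

end PMFReal

section LeftoverHash

variable {Ω 𝒳 𝒮 𝒴 Y : Type*} [Fintype Ω] [Fintype 𝒮] [Fintype 𝒴] [Fintype Y]
  [DecidableEq 𝒳] [DecidableEq 𝒴] [DecidableEq Y]

omit [DecidableEq 𝒳] in
lemma UniversalHash.card_filter_le [Nonempty 𝒮] {H : 𝒳 → 𝒮 → Y} (hH : UniversalHash H)
    {x y : 𝒳} (hxy : x ≠ y) :
    (#{s | H x s = H y s} : ℝ) ≤ Fintype.card 𝒮 / Fintype.card Y := by
  have h := hH x y hxy
  have hS : (0 : ℝ) < Fintype.card 𝒮 := by exact_mod_cast Fintype.card_pos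
  rw [div_le_iff₀ hS] at h
  calc _ ≤ _ := h
    _ = _ := by ring

/-- Squared deviation from uniform of the hash of a subdistribution `μ`, in terms of a bound `M`
on the point masses of `X` under `μ`. -/
lemma UniversalHash.sum_sq_le [Nonempty 𝒮] [Nonempty Y] {H : 𝒳 → 𝒮 → Y} (hH : UniversalHash H)
    (μ : Ω → ℝ) (hμ : ∀ w, 0 ≤ μ w) (X : Ω → 𝒳) (M : ℝ)
    (hM : ∀ w₀, ∑ w, (if X w = X w₀ then μ w else 0) ≤ M) :
    ∑ z, ∑ b, (∑ w, μ w * ((if H (X w) z = b then 1 else 0) - (Fintype.card Y : ℝ)⁻¹)) ^ 2 ≤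
      Fintype.card 𝒮 * ((∑ w, μ w) * M) := by
  set V : ℝ := (Fintype.card Y : ℝ) with hV
  set S : ℝ := (Fintype.card 𝒮 : ℝ) with hS
  have hV0 : 0 < V := by rw [hV]; exact_mod_cast Fintype.card_pos
  have hS0 : 0 < S := by rw [hS]; exact_mod_cast Fintype.card_pos
  have expand (z : 𝒮) :
      ∑ b, (∑ w, μ w * ((if H (X w) z = b then 1 else 0) - V⁻¹)) ^ 2 =
        ∑ w, ∑ w', μ w * μ w' * ((if H (X w) z = H (X w') z then 1 else 0) - V⁻¹) := by
    simp only [sq, sum_mul_sum]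
    rw [sum_comm]
    refine sum_congr rfl fun w _ => ?_
    rw [sum_comm]
    refine sum_congr rfl fun w' _ => ?_
    have (b : Y) : μ w * ((if H (X w) z = b then 1 else 0) - V⁻¹) *
        (μ w' * ((if H (X w') z = b then 1 else 0) - V⁻¹)) =
        μ w * μ w' * ((if H (X w) z = b then (if H (X w') z = b then 1 else 0) else 0)
          - V⁻¹ * (if H (X w) z = b then 1 else 0) - V⁻¹ * (if H (X w') z = b then 1 else 0)
          + V⁻¹ * V⁻¹) := by
      split_ifs <;> ring
    simp only [this, ← mul_sum, sum_add_distrib, sum_sub_distrib, sum_ite_eq, mem_univ, if_true,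
      sum_const, card_univ, nsmul_eq_mul, ← hV]
    rw [mul_inv_cancel₀ hV0.ne']
    simp only [eq_comm (a := H (X w') z)]
    ring
  simp only [expand]
  rw [sum_comm]
  calc ∑ w, ∑ z, ∑ w', μ w * μ w' * ((if H (X w) z = H (X w') z then 1 else 0) - V⁻¹)
      ≤ ∑ w, μ w * (S * M) := by
        refine sum_le_sum fun w _ => ?_
        rw [sum_comm]
        calc _ ≤ ∑ w', μ w * (S * (if X w' = X w then μ w' else 0)) := by
              refine sum_le_sum fun w' _ => ?_
              rw [← mul_sum, sum_sub_distrib, sum_boole, sum_const, card_univ, nsmul_eq_mul,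
                ← hS, mul_assoc]
              refine mul_le_mul_of_nonneg_left ?_ (hμ w)
              by_cases hx : X w' = X w
              · simp only [hx, if_true, filter_true, card_univ, ← hS]
                rw [mul_comm S (μ w')]
                refine mul_le_mul_of_nonneg_left ?_ (hμ w')
                have : 0 ≤ S * V⁻¹ := by positivity
                linarith
              · simp only [hx, if_false, mul_zero]
                refine mul_nonpos_of_nonneg_of_nonpos (hμ w') ?_
                have := hH.card_filter_le (Ne.symm hx)
                rw [← hS, ← hV, div_eq_mul_inv] at this
                linarith
          _ ≤ _ := by
              rw [← mul_sum, ← mul_sum]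
              gcongr
              · exact hμ w
              · exact hM w
    _ = _ := by rw [← sum_mul]; ring

/-- Leftover hash lemma for a subdistribution. -/
lemma UniversalHash.sum_abs_le [Nonempty 𝒮] [Nonempty Y] {H : 𝒳 → 𝒮 → Y} (hH : UniversalHash H)
    (μ : Ω → ℝ) (hμ : ∀ w, 0 ≤ μ w) (X : Ω → 𝒳) (M : ℝ)
    (hM : ∀ w₀, ∑ w, (if X w = X w₀ then μ w else 0) ≤ M) :
    ∑ z, ∑ b, |∑ w, μ w * ((if H (X w) z = b then 1 else 0) - (Fintype.card Y : ℝ)⁻¹)| ≤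
      Fintype.card 𝒮 * √(Fintype.card Y * ((∑ w, μ w) * M)) := by
  rw [← Fintype.sum_prod_type']
  have hcs := sq_sum_le_card_mul_sum_sq (s := (univ : Finset (𝒮 × Y)))
    (f := fun p => |∑ w, μ w * ((if H (X w) p.1 = p.2 then 1 else 0) - (Fintype.card Y : ℝ)⁻¹)|)
  simp only [sq_abs] at hcs
  rw [Fintype.sum_prod_type (f := fun p : 𝒮 × Y => (∑ w, μ w *
    ((if H (X w) p.1 = p.2 then 1 else 0) - (Fintype.card Y : ℝ)⁻¹)) ^ 2)] at hcs
  refine (Real.le_sqrt_of_sq_le (hcs.trans (mul_le_mul_of_nonneg_left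
    (hH.sum_sq_le μ hμ X M hM) (Nat.cast_nonneg _)))).trans_eq ?_
  rw [card_univ, Fintype.card_prod, Nat.cast_mul]
  rw [show (Fintype.card 𝒮 : ℝ) * Fintype.card Y * (Fintype.card 𝒮 * ((∑ w, μ w) * M)) =
    (Fintype.card 𝒮 : ℝ) ^ 2 * (Fintype.card Y * ((∑ w, μ w) * M)) by ring,
    Real.sqrt_mul (sq_nonneg _), Real.sqrt_sq (Nat.cast_nonneg _)]

/-- Optimal probability of guessing `X` given `C`, under the weights `μ`. -/
def guessProb [Fintype 𝒳] (μ : Ω → ℝ) (X : Ω → 𝒳) (C : Ω → 𝒴) : ℝ :=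
  ∑ y, ⨆ x, ∑ w, if X w = x ∧ C w = y then μ w else 0

/-- Leftover hash lemma with side information `C`: the distance from uniform is bounded by the
probability of guessing from `C` any function `X'` of the hashed value `X`. -/
lemma UniversalHash.sum_abs_le_guessProb {𝒳' : Type*} [Fintype 𝒳'] [DecidableEq 𝒳']
    [Nonempty 𝒮] [Nonempty Y] {H : 𝒳 → 𝒮 → Y} (hH : UniversalHash H)
    (μ : Ω → ℝ) (hμ : ∀ w, 0 ≤ μ w) (hμ1 : ∑ w, μ w = 1) (X : Ω → 𝒳) (X' : Ω → 𝒳')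
    (hX : ∀ w w', X w = X w' → X' w = X' w') (C : Ω → 𝒴) :
    ∑ z, ∑ y, ∑ b, |∑ w, (if C w = y then μ w else 0) *
        ((if H (X w) z = b then 1 else 0) - (Fintype.card Y : ℝ)⁻¹)| ≤
      Fintype.card 𝒮 * √(Fintype.card Y * guessProb μ X' C) := by
  rw [sum_comm]
  set q : 𝒴 → ℝ := fun y => ∑ w, if C w = y then μ w else 0 with hq
  set M : 𝒴 → ℝ := fun y => ⨆ x, ∑ w, if X' w = x ∧ C w = y then μ w else 0 with hMdef
  have hq0 (y) : 0 ≤ q y := sum_nonneg fun w _ => by split_ifs <;> simp [hμ]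
  have hM0 (y) : 0 ≤ M y := Real.iSup_nonneg fun x => sum_nonneg fun w _ => by
    split_ifs <;> simp [hμ]
  have hq1 : ∑ y, q y = 1 := by
    rw [hq, sum_comm, ← hμ1]
    simp
  have step (y : 𝒴) : ∑ z, ∑ b, |∑ w, (if C w = y then μ w else 0) *
      ((if H (X w) z = b then 1 else 0) - (Fintype.card Y : ℝ)⁻¹)| ≤
      Fintype.card 𝒮 * (√(Fintype.card Y) * (√(q y) * √(M y))) := by
    rw [← Real.sqrt_mul (hq0 y), ← Real.sqrt_mul (Nat.cast_nonneg _)]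
    refine hH.sum_abs_le (fun w => if C w = y then μ w else 0)
      (fun w => by split_ifs <;> simp [hμ]) X (M y) fun w₀ => ?_
    refine le_trans ?_ (le_ciSup (Set.finite_range _).bddAbove (X' w₀))
    refine sum_le_sum fun w _ => ?_
    by_cases h1 : X w = X w₀
    · simp [h1, hX _ _ h1]
    · simp only [h1, if_false]
      split_ifs <;> simp [hμ]
  refine (sum_le_sum fun y _ => step y).trans ?_
  rw [← mul_sum, ← mul_sum, Real.sqrt_mul (Nat.cast_nonneg _)]
  gcongr
  refine (Real.sum_sqrt_mul_sqrt_le univ hq0 hM0).trans_eq ?_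
  rw [hq1, Real.sqrt_one, one_mul]
  rfl

end LeftoverHash

section Hybrid

variable {Ω 𝒴 Y ι : Type*} [Fintype Ω] [Fintype 𝒴] [Fintype Y] [Fintype ι]
  [DecidableEq 𝒴] [DecidableEq Y] [DecidableEq ι]

/-- Mass function of the hybrid in which the coordinates in `s` are replaced by uniform ones. -/
def hybridMass (μ : Ω → ℝ) (h : Ω → ι → Y) (s : Finset ι) (v : ι → Y) : ℝ :=
  ∑ w, μ w * ∏ i, if i ∈ s then (Fintype.card Y : ℝ)⁻¹ else if h w i = v i then 1 else 0

lemma hybridMass_empty (μ : Ω → ℝ) (h : Ω → ι → Y) (v : ι → Y) :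
    hybridMass μ h ∅ v = ∑ w, μ w * if h w = v then 1 else 0 := by
  simp [hybridMass, prod_ite_zero, funext_iff]

lemma hybridMass_univ (μ : Ω → ℝ) (h : Ω → ι → Y) (v : ι → Y) :
    hybridMass μ h univ v = (∑ w, μ w) * (Fintype.card (ι → Y) : ℝ)⁻¹ := by
  simp [hybridMass, sum_mul]

lemma sum_abs_hybridMass_insert_le [Nonempty Y] (μ : Ω → ℝ) (h : Ω → ι → Y) (s : Finset ι) (k : ι)
    (hk : k ∉ s) (C : Ω → 𝒴) (η : ι → 𝒴 → Y) (hη : ∀ j, j ≠ k → ∀ w, h w j = η j (C w)) :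
    ∑ v, |hybridMass μ h s v - hybridMass μ h (insert k s) v| ≤
      ∑ y, ∑ b, |∑ w, (if C w = y then μ w else 0) *
        ((if h w k = b then 1 else 0) - (Fintype.card Y : ℝ)⁻¹)| := by
  set V : ℝ := (Fintype.card Y : ℝ) with hV
  have hV0 : 0 < V := by rw [hV]; exact_mod_cast Fintype.card_pos
  set D : 𝒴 → Y → ℝ := fun y b => ∑ w, (if C w = y then μ w else 0) *
    ((if h w k = b then 1 else 0) - V⁻¹) with hD
  set q : 𝒴 → ι → Y → ℝ := fun y i b => if i ∈ s then V⁻¹ else if η i y = b then 1 else 0 with hqdef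
  have hq0 (y i b) : 0 ≤ q y i b := by
    simp only [hqdef]
    split_ifs <;> positivity
  have hq1 (y i) : ∑ b, q y i b = 1 := by
    by_cases hi : i ∈ s
    · simp [hqdef, hi, ← hV, hV0.ne']
    · simp [hqdef, hi]
  have diff (v : ι → Y) : hybridMass μ h s v - hybridMass μ h (insert k s) v =
      ∑ y, D y (v k) * ∏ i ∈ univ.erase k, q y i (v i) := by
    simp only [hD, sum_mul]
    rw [sum_comm, hybridMass, hybridMass, ← sum_sub_distrib]
    refine sum_congr rfl fun w _ => ?_
    rw [← mul_prod_erase univ _ (mem_univ k), ← mul_prod_erase univ (a := k)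
      (fun i => if i ∈ insert k s then V⁻¹ else if h w i = v i then (1 : ℝ) else 0) (mem_univ k)]
    have e1 : ∏ i ∈ univ.erase k, (if i ∈ s then V⁻¹ else if h w i = v i then (1 : ℝ) else 0) =
        ∏ i ∈ univ.erase k, q (C w) i (v i) := prod_congr rfl fun i hi => by
      simp only [hqdef, hη i (ne_of_mem_erase hi)]
    have e2 : ∏ i ∈ univ.erase k,
        (if i ∈ insert k s then V⁻¹ else if h w i = v i then (1 : ℝ) else 0) =
        ∏ i ∈ univ.erase k, q (C w) i (v i) := prod_congr rfl fun i hi => by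
      simp only [hqdef, hη i (ne_of_mem_erase hi), mem_insert, ne_of_mem_erase hi, false_or]
    rw [e1, e2]
    simp only [hk, if_false, mem_insert_self, if_true, ite_mul, zero_mul, sum_ite_eq, mem_univ]
    split_ifs <;> ring
  calc ∑ v, |hybridMass μ h s v - hybridMass μ h (insert k s) v|
      ≤ ∑ v : ι → Y, ∑ y, ∏ i, (if i = k then |D y (v i)| else q y i (v i)) := by
        refine sum_le_sum fun v _ => ?_
        rw [diff]
        refine (abs_sum_le_sum_abs _ _).trans_eq (sum_congr rfl fun y _ => ?_)
        rw [← mul_prod_erase univ _ (mem_univ k), abs_mul,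
          abs_of_nonneg (prod_nonneg fun i _ => hq0 y i (v i)), if_pos rfl]
        congr 1
        exact prod_congr rfl fun i hi => by rw [if_neg (ne_of_mem_erase hi)]
    _ = ∑ y, ∏ i, ∑ b, (if i = k then |D y b| else q y i b) := by
        rw [sum_comm]
        refine sum_congr rfl fun y _ => ?_
        rw [prod_univ_sum, Fintype.piFinset_univ]
    _ = _ := by
        refine sum_congr rfl fun y _ => ?_
        rw [← mul_prod_erase univ _ (mem_univ k), prod_eq_one, mul_one]
        · simp [hD]
        · intro i hi
          simp only [if_neg (ne_of_mem_erase hi), hq1]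

/-- Hybrid argument: a random vector is close to uniform if each coordinate is, given side
information determining all the others. -/
lemma sum_abs_sub_uniform_le [Nonempty Y] (μ : Ω → ℝ) (h : Ω → ι → Y)
    (C : ι → Ω → 𝒴) (η : ι → 𝒴 → Y) (hη : ∀ k j, j ≠ k → ∀ w, h w j = η j (C k w)) :
    ∑ v, |(∑ w, μ w * if h w = v then 1 else 0) - (∑ w, μ w) * (Fintype.card (ι → Y) : ℝ)⁻¹| ≤
      ∑ k, ∑ y, ∑ b, |∑ w, (if C k w = y then μ w else 0) *
        ((if h w k = b then 1 else 0) - (Fintype.card Y : ℝ)⁻¹)| := by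
  have main (s : Finset ι) : ∑ v, |hybridMass μ h ∅ v - hybridMass μ h s v| ≤
      ∑ k ∈ s, ∑ y, ∑ b, |∑ w, (if C k w = y then μ w else 0) *
        ((if h w k = b then 1 else 0) - (Fintype.card Y : ℝ)⁻¹)| := by
    induction s using Finset.induction_on with
    | empty => simp
    | insert k s hk ih =>
      rw [sum_insert hk, add_comm]
      refine le_trans ?_ (add_le_add ih (sum_abs_hybridMass_insert_le μ h s k hk (C k) η (hη k)))
      rw [← sum_add_distrib]
      exact sum_le_sum fun v _ => abs_sub_le _ _ _
  simpa only [hybridMass_empty, hybridMass_univ] using main univ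

end Hybrid

section Subsets

variable {α : Type*} [Fintype α] [DecidableEq α] {m N : ℕ}

/-- The action of a permutation on the `m`-subsets. -/
def permSubset (m : ℕ) (π : Equiv.Perm α) : Equiv.Perm {A : Finset α // A.card = m} :=
  π.finsetCongr.subtypeEquiv fun A => by simp

omit [Fintype α] [DecidableEq α] in
lemma permSubset_coe (π : Equiv.Perm α) (A : {A : Finset α // A.card = m}) :
    (permSubset m π A : Finset α) = A.1.map π.toEmbedding := rfl

lemma exists_permSubset_eq (A B : {A : Finset α // A.card = m}) : ∃ π, permSubset m π A = B := by
  refine ⟨(Finset.equivOfCardEq (A.2.trans B.2.symm)).extendSubtype, Subtype.ext ?_⟩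
  rw [permSubset_coe]
  refine eq_of_subset_of_card_le (fun x hx => ?_) (by rw [card_map, A.2, B.2])
  obtain ⟨a, ha, rfl⟩ := mem_map.1 hx
  exact (Finset.equivOfCardEq (A.2.trans B.2.symm)).extendSubtype_mem a ha

/-- The image of a fixed subset under a uniformly random permutation is uniform. -/
lemma card_mul_sum_permSubset (f : {A : Finset α // A.card = N} → ℝ)
    (B₀ : {A : Finset α // A.card = N}) :
    (Fintype.card {A : Finset α // A.card = N} : ℝ) * ∑ π, f (permSubset N π B₀) =
      Fintype.card (Equiv.Perm α) * ∑ B, f B := by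
  have const (B) : ∑ π, f (permSubset N π B) = ∑ π, f (permSubset N π B₀) := by
    obtain ⟨ρ, rfl⟩ := exists_permSubset_eq B₀ B
    rw [← Equiv.sum_comp (Equiv.mulRight ρ) fun π => f (permSubset N π B₀)]
    refine sum_congr rfl fun π _ => congrArg f (Subtype.ext ?_)
    simp only [permSubset_coe, map_map]
    rfl
  calc _ = ∑ B, ∑ π, f (permSubset N π B) := by simp [const]
    _ = _ := by
      rw [sum_comm]
      simp [Equiv.sum_comp]

lemma card_mul_sum_eval {ι T : Type*} [Fintype ι] [DecidableEq ι] [Fintype T] (k : ι) (f : T → ℝ) :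
    (Fintype.card T : ℝ) * ∑ A : ι → T, f (A k) = Fintype.card (ι → T) * ∑ a, f a := by
  rw [Fintype.card_congr (Equiv.funSplitAt k T), ← Equiv.sum_comp (Equiv.funSplitAt k T).symm,
    Fintype.sum_prod_type, Fintype.card_prod, Nat.cast_mul, mul_assoc, mul_sum]
  simp [Equiv.funSplitAt, Equiv.piSplitAt, mul_sum]

/-- If `F a B` is monotone in `B`, then averaging it over `B` the union of at most `N / m` random
`m`-subsets independent of `a` gives at most the average over a random `N`-subset `B`. -/
lemma sum_biUnion_erase_le {ι : Type*} [Fintype ι] [DecidableEq ι] (hN : N ≤ Fintype.card α)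
    (hk : Fintype.card ι * m ≤ N) (F : {A : Finset α // A.card = m} → Finset α → ℝ)
    (hF : ∀ a, Monotone (F a)) (k : ι) :
    (Fintype.card {A : Finset α // A.card = m} * Fintype.card {A : Finset α // A.card = N} : ℝ) *
      ∑ A : ι → {A : Finset α // A.card = m},
        F (A k) ((univ.erase k).biUnion fun j => (A j).1) ≤
    Fintype.card (ι → {A : Finset α // A.card = m}) *
      ∑ a, ∑ B : {A : Finset α // A.card = N}, F a B.1 := by
  set U : (ι → {A : Finset α // A.card = m}) → Finset α :=
    fun A => (univ.erase k).biUnion fun j => (A j).1 with hU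
  have hcard (A) : #(U A) ≤ N := by
    refine card_biUnion_le.trans (le_trans ?_ hk)
    simp only [(A _).2, sum_const, smul_eq_mul]
    exact Nat.mul_le_mul_right _ (card_le_univ _)
  have hB (A) : ∃ B : {A : Finset α // A.card = N}, U A ⊆ B.1 := by
    obtain ⟨B, h1, h2⟩ := exists_superset_card_eq (hcard A) hN
    exact ⟨⟨B, h2⟩, h1⟩
  choose B₀ hB₀ using hB
  have shift (π : Equiv.Perm α) :
      ∑ A, F (A k) (U A) = ∑ A, F (A k) ((U A).map π.toEmbedding) := by
    rw [← Equiv.sum_comp (Equiv.piCongrRight fun j => if j = k then Equiv.refl _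
      else permSubset m π)]
    refine sum_congr rfl fun A _ => ?_
    have h1 : (U fun j => (if j = k then Equiv.refl _ else permSubset m π) (A j)) =
        (U A).map π.toEmbedding := by
      simp only [hU, map_eq_image, biUnion_image]
      refine biUnion_congr rfl fun j hj => ?_
      rw [if_neg (ne_of_mem_erase hj), permSubset_coe, map_eq_image]
    rw [← h1]
    refine congrArg₂ F ?_ rfl
    simp
  have hP : (0 : ℝ) < Fintype.card (Equiv.Perm α) := by exact_mod_cast Fintype.card_pos
  refine le_of_mul_le_mul_left ?_ hP
  calc _ = (Fintype.card {A : Finset α // A.card = m} : ℝ) *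
        (Fintype.card {A : Finset α // A.card = N} *
          ∑ π : Equiv.Perm α, ∑ A, F (A k) ((U A).map π.toEmbedding)) := by
        simp only [← shift, sum_const, card_univ, nsmul_eq_mul]
        ring
    _ ≤ (Fintype.card {A : Finset α // A.card = m} : ℝ) *
        (Fintype.card {A : Finset α // A.card = N} *
          ∑ π : Equiv.Perm α, ∑ A, F (A k) (permSubset N π (B₀ A)).1) := by
        gcongr with π _ A _
        exact hF _ (map_subset_map.2 (hB₀ A))
    _ = (Fintype.card {A : Finset α // A.card = m} : ℝ) * ∑ A : ι → {A : Finset α // A.card = m},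
          (Fintype.card (Equiv.Perm α) *
            ∑ B : {A : Finset α // A.card = N}, F (A k) B.1) := by
        rw [sum_comm, mul_sum]
        congr 1
        exact sum_congr rfl fun A _ => card_mul_sum_permSubset (fun B => F (A k) B.1) (B₀ A)
    _ = _ := by
        rw [← mul_sum, mul_left_comm,
          card_mul_sum_eval k fun a => ∑ B : {A : Finset α // A.card = N}, F a B.1]

end Subsets

section Source

variable {n m N : ℕ}

lemma guessProb_nonneg {Ω 𝒳 𝒴 : Type*} [Fintype Ω] [Fintype 𝒳] [Fintype 𝒴] [DecidableEq 𝒳]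
    [DecidableEq 𝒴] (μ : Ω → ℝ) (hμ : ∀ w, 0 ≤ μ w) (X : Ω → 𝒳) (C : Ω → 𝒴) :
    0 ≤ guessProb μ X C :=
  sum_nonneg fun y _ => Real.iSup_nonneg fun x => sum_nonneg fun w _ => by
    split_ifs <;> simp [hμ]

/-- More side information helps guessing. -/
lemma guessProb_comp_le {Ω 𝒳 𝒴 𝒴' : Type*} [Fintype Ω] [Fintype 𝒳] [Fintype 𝒴] [Fintype 𝒴']
    [DecidableEq 𝒳] [DecidableEq 𝒴] [DecidableEq 𝒴'] (μ : Ω → ℝ) (hμ : ∀ w, 0 ≤ μ w)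
    (X : Ω → 𝒳) (C : Ω → 𝒴) (ρ : 𝒴 → 𝒴') :
    guessProb μ X (fun w => ρ (C w)) ≤ guessProb μ X C := by
  rw [guessProb, guessProb, ← sum_fiberwise univ ρ]
  refine sum_le_sum fun y' _ => ?_
  refine Real.iSup_le (fun x => ?_) (sum_nonneg fun y _ => Real.iSup_nonneg fun x =>
    sum_nonneg fun w _ => by split_ifs <;> simp [hμ])
  calc (∑ w, if X w = x ∧ ρ (C w) = y' then μ w else 0)
      = ∑ y with ρ y = y', ∑ w, if X w = x ∧ C w = y then μ w else 0 := by
        rw [sum_comm]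
        refine sum_congr rfl fun w _ => ?_
        rw [sum_filter]
        simp only [← ite_and]
        by_cases h : X w = x ∧ ρ (C w) = y'
        · rw [if_pos h, Fintype.sum_eq_single (C w)]
          · simp [h]
          · intro y hy
            rw [if_neg fun h' => hy h'.2.2.symm]
        · rw [if_neg h, sum_eq_zero]
          intro y _
          rw [if_neg]
          rintro ⟨h1, h2, rfl⟩
          exact h ⟨h2, h1⟩
    _ ≤ _ := sum_le_sum fun y _ => le_ciSup
        (f := fun x => ∑ w, if X w = x ∧ C w = y then μ w else 0) (Set.finite_range _).bddAbove x

lemma guessProb_subsample_mono {𝒳 : Type*} [Fintype 𝒳] [DecidableEq 𝒳] (μ : (Fin n → Bool) → ℝ)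
    (hμ : ∀ w, 0 ≤ μ w) (X : (Fin n → Bool) → 𝒳) :
    Monotone fun B : Finset (Fin n) => guessProb μ X fun w => subsample w B := by
  intro C B hCB
  have restrict : (fun w : Fin n → Bool => subsample w C) =
      fun w i => if i ∈ C then subsample w B i else none := by
    funext w i
    by_cases h : i ∈ C
    · simp [subsample, h, hCB h]
    · simp [subsample, h]
  simp only [restrict]
  exact guessProb_comp_le μ hμ X (fun w => subsample w B) fun y i => if i ∈ C then y i else none

lemma sampleBits_eq_subsample (w : Fin n → Bool) (A : {s : Finset (Fin n) // s.card = m})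
    (C : Finset (Fin n)) (h : A.1 ⊆ C) :
    sampleBits w A = fun i => (subsample w C (A.1.orderIsoOfFin A.2 i).1).getD false := by
  funext i
  have hi := h (A.1.orderIsoOfFin A.2 i).2
  simp only [sampleBits, subsample, if_pos hi, Option.getD_some]

lemma subsample_eq_of_sampleBits_eq (w w' : Fin n → Bool)
    (A : {s : Finset (Fin n) // s.card = m}) (h : sampleBits w A = sampleBits w' A) :
    subsample w A.1 = subsample w' A.1 := by
  ext1 i
  by_cases hi : i ∈ A.1
  · have := congrFun h ((A.1.orderIsoOfFin A.2).symm ⟨i, hi⟩)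
    simpa [subsample, hi, sampleBits] using this
  · simp [subsample, hi]

lemma toReal_uniformSubset (hm : m ≤ Fintype.card (Fin n))
    (A : {s : Finset (Fin n) // s.card = m}) : (uniformSubset (Fin n) m hm A).toReal =
      (Fintype.card {s : Finset (Fin n) // s.card = m} : ℝ)⁻¹ :=
  haveI := mSub_nonempty hm
  PMF.toReal_uniformOfFintype_apply A

lemma IsAlphaSource.sum_guessProb_le {Wd : PMF (Fin n → Bool)} {α : ℝ} {hm : m ≤ n} {hN : N ≤ n}
    (hW : IsAlphaSource n Wd α m N hm hN) :
    ∑ a : {s : Finset (Fin n) // s.card = m}, ∑ B : {s : Finset (Fin n) // s.card = N},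
      guessProb (fun w => (Wd w).toReal) (fun w => subsample w a.1) (fun w => subsample w B.1) ≤
    (Fintype.card {s : Finset (Fin n) // s.card = m} *
      Fintype.card {s : Finset (Fin n) // s.card = N}) * (2 : ℝ) ^ (-α) := by
  classical
  have hm' : m ≤ Fintype.card (Fin n) := by simpa using hm
  have hN' : N ≤ Fintype.card (Fin n) := by simpa using hN
  have := mSub_nonempty hm'
  have := mSub_nonempty hN'
  set cm : ℝ := (Fintype.card {s : Finset (Fin n) // s.card = m} : ℝ) with hcm
  set cN : ℝ := (Fintype.card {s : Finset (Fin n) // s.card = N} : ℝ) with hcN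
  have hcm0 : 0 < cm := by rw [hcm]; exact_mod_cast Fintype.card_pos
  have hcN0 : 0 < cN := by rw [hcN]; exact_mod_cast Fintype.card_pos
  set μ := Wd.bind fun w => (uniformSubset (Fin n) m hm').bind fun A =>
    (uniformSubset (Fin n) N hN').bind fun B =>
      PMF.pure (subsample w A.1, (subsample w B.1, A, B)) with hμ
  have hW' : α ≤ avgCondMinEntropy μ := hW
  have hval (x y) (a : {s : Finset (Fin n) // s.card = m})
      (b : {s : Finset (Fin n) // s.card = N}) : (μ (x, (y, a, b))).toReal =
      cm⁻¹ * cN⁻¹ *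
        ∑ w, if subsample w a.1 = x ∧ subsample w b.1 = y then (Wd w).toReal else 0 := by
    rw [hμ, PMF.toReal_bind_apply, mul_sum]
    refine sum_congr rfl fun w _ => ?_
    rw [PMF.toReal_bind_apply, Fintype.sum_eq_single a, PMF.toReal_bind_apply,
      Fintype.sum_eq_single b, PMF.toReal_pure_apply, toReal_uniformSubset, toReal_uniformSubset]
    · simp only [Prod.mk.injEq, and_true, ← hcm, ← hcN]
      split_ifs <;> ring
    · intro b' hb'
      rw [PMF.toReal_pure_apply, if_neg (by simp [hb']), mul_zero]
    · intro a' ha'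
      rw [PMF.toReal_bind_apply, sum_eq_zero, mul_zero]
      intro b' _
      rw [PMF.toReal_pure_apply, if_neg (by simp [ha']), mul_zero]
  have hsum : ∑ y, ⨆ x, (μ (x, y)).toReal = cm⁻¹ * cN⁻¹ *
      ∑ a : {s : Finset (Fin n) // s.card = m}, ∑ B : {s : Finset (Fin n) // s.card = N},
        guessProb (fun w => (Wd w).toReal) (fun w => subsample w a.1)
          (fun w => subsample w B.1) := by
    rw [Fintype.sum_prod_type, sum_comm, Fintype.sum_prod_type, mul_sum]
    refine sum_congr rfl fun a _ => ?_
    rw [mul_sum]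
    refine sum_congr rfl fun b _ => ?_
    rw [guessProb, mul_sum]
    refine sum_congr rfl fun y _ => ?_
    simp only [hval]
    rw [Real.mul_iSup_of_nonneg (by positivity)]
  set s := ∑ y, ⨆ x, (μ (x, y)).toReal with hs
  have hs0 : 0 ≤ s := sum_nonneg fun y _ => Real.iSup_nonneg fun x => ENNReal.toReal_nonneg
  have hle : s ≤ (2 : ℝ) ^ (-α) := by
    rcases hs0.eq_or_lt with h | h
    · rw [← h]; positivity
    · rw [avgCondMinEntropy, ← hs] at hW'
      exact (Real.logb_le_iff_le_rpow one_lt_two h).1 (by linarith)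
  rw [hsum, ← mul_inv, inv_mul_le_iff₀ (by positivity)] at hle
  exact hle

end Source

section Construction

variable {n m N ℓ : ℕ}

lemma sum_sqrt_le_card_mul_sqrt {ι : Type*} [Fintype ι] (x : ι → ℝ) (hx : ∀ i, 0 ≤ x i) (c : ℝ)
    (h : ∑ i, x i ≤ Fintype.card ι * c) : ∑ i, √(x i) ≤ Fintype.card ι * √c := by
  have hcs := sq_sum_le_card_mul_sum_sq (s := (univ : Finset ι)) (f := fun i => √(x i))
  simp only [Real.sq_sqrt (hx _), card_univ] at hcs
  refine (Real.le_sqrt_of_sq_le (hcs.trans (mul_le_mul_of_nonneg_left h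
    (Nat.cast_nonneg _)))).trans_eq ?_
  rw [← mul_assoc, ← sq, Real.sqrt_mul (sq_nonneg _), Real.sqrt_sq (Nat.cast_nonneg _)]

/-- The part of `w` read by the samples other than the `k`-th one. -/
def otherSamples (A : Fin ℓ → {s : Finset (Fin n) // s.card = m}) (k : Fin ℓ)
    (w : Fin n → Bool) : Fin n → Option Bool :=
  subsample w ((univ.erase k).biUnion fun j => (A j).1)

variable {𝒮 Y : Type} [Fintype 𝒮] [Fintype Y] [DecidableEq Y] [Nonempty Y]

/-- Deviation from uniform of the `k`-th hash value given the other samples, for a fixed seed. -/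
def hashDeviation (Wd : PMF (Fin n → Bool)) (H : (Fin m → Bool) → 𝒮 → Y) (z : 𝒮)
    (A : Fin ℓ → {s : Finset (Fin n) // s.card = m}) (k : Fin ℓ) : ℝ :=
  ∑ y, ∑ b, |∑ w, (if otherSamples A k w = y then (Wd w).toReal else 0) *
    ((if H (sampleBits w (A k)) z = b then 1 else 0) - (Fintype.card Y : ℝ)⁻¹)|

omit [Fintype 𝒮] in
lemma statDist_hashes_uniform_le (Wd : PMF (Fin n → Bool)) (H : (Fin m → Bool) → 𝒮 → Y) (z : 𝒮)
    (A : Fin ℓ → {s : Finset (Fin n) // s.card = m}) :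
    statDist (Wd.bind fun w => PMF.pure fun i => H (sampleBits w (A i)) z)
      (PMF.uniformOfFintype (Fin ℓ → Y)) ≤ 1 / 2 * ∑ k, hashDeviation Wd H z A k := by
  have key := sum_abs_sub_uniform_le (fun w => (Wd w).toReal)
    (fun w i => H (sampleBits w (A i)) z) (otherSamples A)
    (fun j y => H (fun i => (y ((A j).1.orderIsoOfFin (A j).2 i).1).getD false) z) (by
      intro k j hj w
      rw [otherSamples, ← sampleBits_eq_subsample w (A j)]
      exact subset_biUnion_of_mem (fun j => (A j).1) (mem_erase.2 ⟨hj, mem_univ j⟩))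
  simp only [statDist, PMF.toReal_bind_apply, PMF.toReal_pure_apply,
    PMF.toReal_uniformOfFintype_apply]
  rw [PMF.sum_toReal_apply, one_mul] at key
  exact mul_le_mul_of_nonneg_left key (by norm_num)

lemma sum_hashDeviation_le [Nonempty 𝒮] {Wd : PMF (Fin n → Bool)} {α : ℝ} {hm : m ≤ n}
    {hN : N ≤ n} (hW : IsAlphaSource n Wd α m N hm hN) {H : (Fin m → Bool) → 𝒮 → Y}
    (hH : UniversalHash H) (hk : ℓ * m ≤ N) (k : Fin ℓ) :
    ∑ A : Fin ℓ → {s : Finset (Fin n) // s.card = m}, ∑ z, hashDeviation Wd H z A k ≤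
      Fintype.card 𝒮 * (Fintype.card (Fin ℓ → {s : Finset (Fin n) // s.card = m}) *
        √(Fintype.card Y * (2 : ℝ) ^ (-α))) := by
  have hμ (w : Fin n → Bool) : 0 ≤ (Wd w).toReal := ENNReal.toReal_nonneg
  set g : {s : Finset (Fin n) // s.card = m} → Finset (Fin n) → ℝ := fun a B =>
    guessProb (fun w => (Wd w).toReal) (fun w => subsample w a.1) (fun w => subsample w B) with hg
  have hA (A : Fin ℓ → {s : Finset (Fin n) // s.card = m}) : ∑ z, hashDeviation Wd H z A k ≤
      Fintype.card 𝒮 *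
        √(Fintype.card Y * g (A k) ((univ.erase k).biUnion fun j => (A j).1)) :=
    hH.sum_abs_le_guessProb _ hμ Wd.sum_toReal_apply (fun w => sampleBits w (A k))
      (fun w => subsample w (A k).1) (fun w w' => subsample_eq_of_sampleBits_eq w w' (A k))
      (otherSamples A k)
  refine (sum_le_sum fun A _ => hA A).trans ?_
  rw [← mul_sum]
  gcongr
  refine sum_sqrt_le_card_mul_sqrt _ (fun A => mul_nonneg (Nat.cast_nonneg _)
    (guessProb_nonneg _ hμ _ _)) _ ?_
  rw [← mul_sum, mul_left_comm]
  gcongr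
  have hm' : m ≤ Fintype.card (Fin n) := by simpa using hm
  have hN' : N ≤ Fintype.card (Fin n) := by simpa using hN
  have := mSub_nonempty hm'
  have := mSub_nonempty hN'
  have h := (sum_biUnion_erase_le (ι := Fin ℓ) (m := m) hN' (by simpa using hk) g
    (fun a => guessProb_subsample_mono _ hμ _) k).trans
      (mul_le_mul_of_nonneg_left hW.sum_guessProb_le (Nat.cast_nonneg _))
  rw [mul_left_comm] at h
  refine le_of_mul_le_mul_left h (mul_pos ?_ ?_) <;> exact_mod_cast Fintype.card_pos

/-- The hash values, seed and sample sets. -/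
def hashedSamples (Wd : PMF (Fin n → Bool)) [Nonempty 𝒮] (hm : m ≤ Fintype.card (Fin n)) (ℓ : ℕ)
    (H : (Fin m → Bool) → 𝒮 → Y) :
    PMF ((Fin ℓ → Y) × 𝒮 × (Fin ℓ → {s : Finset (Fin n) // s.card = m})) :=
  (PMF.uniformOfFintype 𝒮).bind fun z => (uniformSubsets (Fin n) m ℓ hm).bind fun A =>
    (Wd.bind fun w => PMF.pure fun i => H (sampleBits w (A i)) z).bind fun u => PMF.pure (u, z, A)

/-- Independent uniform values in place of the hash values. -/
def uniformSamples (𝒮 Y : Type) [Fintype 𝒮] [Fintype Y] [Nonempty Y] [Nonempty 𝒮]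
    (hm : m ≤ Fintype.card (Fin n)) (ℓ : ℕ) :
    PMF ((Fin ℓ → Y) × 𝒮 × (Fin ℓ → {s : Finset (Fin n) // s.card = m})) :=
  (PMF.uniformOfFintype 𝒮).bind fun z => (uniformSubsets (Fin n) m ℓ hm).bind fun A =>
    (PMF.uniformOfFintype (Fin ℓ → Y)).bind fun u => PMF.pure (u, z, A)

lemma toReal_uniformSubsets (hm : m ≤ Fintype.card (Fin n))
    (A : Fin ℓ → {s : Finset (Fin n) // s.card = m}) : (uniformSubsets (Fin n) m ℓ hm A).toReal =
      (Fintype.card (Fin ℓ → {s : Finset (Fin n) // s.card = m}) : ℝ)⁻¹ :=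
  haveI := mSub_nonempty hm
  PMF.toReal_uniformOfFintype_apply A

lemma statDist_hashedSamples_le [Nonempty 𝒮] {Wd : PMF (Fin n → Bool)} {α : ℝ} {hm : m ≤ n}
    {hN : N ≤ n} (hW : IsAlphaSource n Wd α m N hm hN) {H : (Fin m → Bool) → 𝒮 → Y}
    (hH : UniversalHash H) (hk : ℓ * m ≤ N) (hm' : m ≤ Fintype.card (Fin n)) :
    statDist (hashedSamples Wd hm' ℓ H) (uniformSamples 𝒮 Y hm' ℓ) ≤
      1 / 2 * (ℓ * √(Fintype.card Y * (2 : ℝ) ^ (-α))) := by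
  have := mSub_nonempty hm'
  set S : ℝ := (Fintype.card 𝒮 : ℝ) with hS
  set T : ℝ := (Fintype.card (Fin ℓ → {s : Finset (Fin n) // s.card = m}) : ℝ) with hT
  have hS0 : 0 < S := by rw [hS]; exact_mod_cast Fintype.card_pos
  have hT0 : 0 < T := by rw [hT]; exact_mod_cast Fintype.card_pos
  calc _ ≤ ∑ z : 𝒮, S⁻¹ * ∑ A : Fin ℓ → {s : Finset (Fin n) // s.card = m},
        T⁻¹ * (1 / 2 * ∑ k, hashDeviation Wd H z A k) := by
        refine (statDist_bind_bind_le _ _ _).trans (sum_le_sum fun z _ => ?_)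
        rw [PMF.toReal_uniformOfFintype_apply]
        refine mul_le_mul_of_nonneg_left ?_ (by positivity)
        refine (statDist_bind_bind_le _ _ _).trans (sum_le_sum fun A _ => ?_)
        rw [toReal_uniformSubsets]
        refine mul_le_mul_of_nonneg_left ?_ (by positivity)
        exact (statDist_bind_le _ _ _).trans (statDist_hashes_uniform_le Wd H z A)
    _ = 1 / 2 * (S⁻¹ * T⁻¹ * ∑ k, ∑ A, ∑ z, hashDeviation Wd H z A k) := by
        simp only [← mul_sum]
        rw [sum_comm (γ := Fin ℓ)]
        simp only [sum_comm (γ := Fin ℓ) (α := 𝒮)]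
        rw [sum_comm]
        ring
    _ ≤ 1 / 2 * (S⁻¹ * T⁻¹ * ∑ _k : Fin ℓ, S * (T * √(Fintype.card Y * (2 : ℝ) ^ (-α)))) := by
        gcongr with k _
        exact sum_hashDeviation_le hW hH hk k
    _ = _ := by
        rw [sum_const, card_univ, Fintype.card_fin, nsmul_eq_mul]
        field_simp

/-- Encryption of the zero-padded key `r` under the one-time pads `u i`. -/
def maskKey {t ξ : ℕ} (r : Fin ξ → Bool) (u : Fin ℓ → Fin (t + ξ) → Bool) :
    Fin ℓ → Fin (t + ξ) → Bool :=
  fun i j => Bool.xor (Fin.append (fun _ : Fin t => false) r j) (u i j)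

lemma maskKey_involutive {t ξ : ℕ} (r : Fin ξ → Bool) :
    Function.Involutive (maskKey (ℓ := ℓ) (t := t) r) := by
  intro u
  funext i j
  simp [maskKey]

lemma uniform_bind_maskKey {t ξ : ℕ} {β : Type*} (r : Fin ξ → Bool)
    (f : (Fin ℓ → Fin (t + ξ) → Bool) → PMF β) :
    ((PMF.uniformOfFintype _).bind fun u => f (maskKey r u)) =
      (PMF.uniformOfFintype _).bind f :=
  PMF.uniformOfFintype_bind_equiv (maskKey_involutive r).toPerm f

lemma mul_sqrt_le_of_entropy {t ξ : ℕ} {α σ : ℝ} (hσ : 0 < σ)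
    (hξ : (ξ : ℝ) ≤ α + 2 - 2 * Real.logb 2 (2 * (ℓ : ℝ) / σ) - (t : ℝ)) :
    ℓ * √((2 : ℝ) ^ (t + ξ) * (2 : ℝ) ^ (-α)) ≤ σ := by
  rcases Nat.eq_zero_or_pos ℓ with rfl | hℓ
  · simpa using hσ.le
  have hℓ' : (0 : ℝ) < ℓ := by exact_mod_cast hℓ
  set L := Real.logb 2 (2 * (ℓ : ℝ) / σ) with hL
  have h2L : (2 : ℝ) ^ L = 2 * ℓ / σ :=
    Real.rpow_logb two_pos (by norm_num) (by positivity)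
  have hle : (2 : ℝ) ^ (t + ξ) * (2 : ℝ) ^ (-α) ≤ (σ / ℓ) ^ 2 := by
    rw [← Real.rpow_natCast, ← Real.rpow_add two_pos]
    calc (2 : ℝ) ^ (((t + ξ : ℕ) : ℝ) + -α) ≤ (2 : ℝ) ^ ((1 - L) * (2 : ℕ)) := by
          refine Real.rpow_le_rpow_of_exponent_le one_le_two ?_
          push_cast
          linarith
      _ = (σ / ℓ) ^ 2 := by
          rw [Real.rpow_mul zero_le_two, Real.rpow_natCast, Real.rpow_sub two_pos, h2L,
            Real.rpow_one]
          congr 1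
          field_simp
  calc _ ≤ ℓ * (σ / ℓ) := by
        gcongr
        exact Real.sqrt_le_iff.2 ⟨by positivity, hle⟩
    _ = σ := by field_simp

end Construction

end Reusability

/-- **security of Construction 1, single enrollment.**
`W` an `(α,m,N)`-source, `H` a universal hash family into `{0,1}^{t+ξ}`,
`ξ ≤ α + 2 − 2·log₂(2ℓ/σ) − t`, `ℓ·m < N`; with `R` uniform over `{0,1}^ξ`, `Z` a uniform
seed and `A_1,…,A_ℓ` independent uniformly random `m`-subsets (all mutually independent of
`W`), set `p_i = (0^t | R) ⊕ H(W[A_i], Z)`.  Then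
`Δ((R, p, Z, A); (U_ξ, p, Z, A)) ≤ σ`. -/
theorem construction1_security
    (n m N t ξ ℓ : ℕ) (α σ : ℝ) (hσ : 0 < σ) (hm : m ≤ n) (hN : N ≤ n)
    (Wd : PMF (Fin n → Bool)) (hW : IsAlphaSource n Wd α m N hm hN)
    (𝒮 : Type) [Fintype 𝒮] [Nonempty 𝒮]
    (H : (Fin m → Bool) → 𝒮 → (Fin (t + ξ) → Bool))
    (hH : UniversalHash H)
    (hξ : (ξ : ℝ) ≤ α + 2 - 2 * Real.logb 2 (2 * (ℓ : ℝ) / σ) - (t : ℝ))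
    (hk : ℓ * m < N) :
    statDist
      (do
        let w ← Wd
        let Z ← PMF.uniformOfFintype 𝒮
        let A ← uniformSubsets (Fin n) m ℓ (by simpa using hm)
        let R ← PMF.uniformOfFintype (Fin ξ → Bool)
        return (R,
          (fun i j => Bool.xor (Fin.append (fun _ : Fin t => false) R j)
            (H (sampleBits w (A i)) Z j)),
          Z, A))
      (do
        let w ← Wd
        let Z ← PMF.uniformOfFintype 𝒮
        let A ← uniformSubsets (Fin n) m ℓ (by simpa using hm)
        let R ← PMF.uniformOfFintype (Fin ξ → Bool)
        let U ← PMF.uniformOfFintype (Fin ξ → Bool)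
        return (U,
          (fun i j => Bool.xor (Fin.append (fun _ : Fin t => false) R j)
            (H (sampleBits w (A i)) Z j)),
          Z, A))
      ≤ σ := by
  have hm' : m ≤ Fintype.card (Fin n) := by simpa using hm
  have hdist := statDist_hashedSamples_le hW hH hk.le hm'
  set keyed := fun x : (Fin ℓ → Fin (t + ξ) → Bool) × 𝒮 ×
      (Fin ℓ → {s : Finset (Fin n) // s.card = m}) =>
    (PMF.uniformOfFintype (Fin ξ → Bool)).bind fun R => PMF.pure (R, maskKey R x.1, x.2)
    with hkeyed
  set rekeyed := fun x : (Fin ℓ → Fin (t + ξ) → Bool) × 𝒮 ×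
      (Fin ℓ → {s : Finset (Fin n) // s.card = m}) =>
    (PMF.uniformOfFintype (Fin ξ → Bool)).bind fun R =>
      (PMF.uniformOfFintype (Fin ξ → Bool)).bind fun U => PMF.pure (U, maskKey R x.1, x.2)
    with hrekeyed
  have hreal (K : (Fin ℓ → Fin (t + ξ) → Bool) × 𝒮 ×
      (Fin ℓ → {s : Finset (Fin n) // s.card = m}) → PMF ((Fin ξ → Bool) ×
        (Fin ℓ → Fin (t + ξ) → Bool) × 𝒮 × (Fin ℓ → {s : Finset (Fin n) // s.card = m}))) :
      (Wd.bind fun w => (PMF.uniformOfFintype 𝒮).bind fun Z =>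
        (uniformSubsets (Fin n) m ℓ hm').bind fun A =>
          K (fun i => H (sampleBits w (A i)) Z, Z, A)) = (hashedSamples Wd hm' ℓ H).bind K := by
    simp only [hashedSamples, PMF.bind_bind, PMF.pure_bind]
    rw [PMF.bind_comm]
    refine congrArg _ (funext fun Z => ?_)
    rw [PMF.bind_comm]
  have hideal : (uniformSamples 𝒮 (Fin (t + ξ) → Bool) hm' ℓ).bind keyed =
      (uniformSamples 𝒮 (Fin (t + ξ) → Bool) hm' ℓ).bind rekeyed := by
    simp only [uniformSamples, PMF.bind_bind, PMF.pure_bind, hkeyed, hrekeyed]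
    refine congrArg _ (funext fun Z => congrArg _ (funext fun A => ?_))
    calc _ = (PMF.uniformOfFintype (Fin ξ → Bool)).bind fun R =>
          (PMF.uniformOfFintype (Fin ℓ → Fin (t + ξ) → Bool)).bind fun u =>
            PMF.pure (R, u, Z, A) := by
          rw [PMF.bind_comm]
          exact congrArg _ (funext fun R =>
            uniform_bind_maskKey R fun u => PMF.pure (R, u, Z, A))
      _ = _ := by
          rw [PMF.bind_comm (PMF.uniformOfFintype (Fin ℓ → Fin (t + ξ) → Bool))
            (PMF.uniformOfFintype (Fin ξ → Bool))]
          have hR (R : Fin ξ → Bool) :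
              ((PMF.uniformOfFintype (Fin ℓ → Fin (t + ξ) → Bool)).bind fun u =>
                (PMF.uniformOfFintype (Fin ξ → Bool)).bind fun U =>
                  PMF.pure (U, maskKey R u, Z, A)) =
              (PMF.uniformOfFintype (Fin ξ → Bool)).bind fun U =>
                (PMF.uniformOfFintype (Fin ℓ → Fin (t + ξ) → Bool)).bind fun u =>
                  PMF.pure (U, u, Z, A) := by
            rw [uniform_bind_maskKey R fun u =>
              (PMF.uniformOfFintype (Fin ξ → Bool)).bind fun U => PMF.pure (U, u, Z, A),
              PMF.bind_comm]
          simp only [hR, PMF.bind_const]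
  have hbound := mul_sqrt_le_of_entropy hσ hξ
  calc _ = statDist ((hashedSamples Wd hm' ℓ H).bind keyed)
        ((hashedSamples Wd hm' ℓ H).bind rekeyed) := by
        rw [← hreal keyed, ← hreal rekeyed]
        rfl
    _ ≤ statDist ((hashedSamples Wd hm' ℓ H).bind keyed)
          ((uniformSamples 𝒮 (Fin (t + ξ) → Bool) hm' ℓ).bind keyed) +
        statDist ((uniformSamples 𝒮 (Fin (t + ξ) → Bool) hm' ℓ).bind rekeyed)
          ((hashedSamples Wd hm' ℓ H).bind rekeyed) := by
        rw [← hideal]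
        exact statDist_triangle _ _ _
    _ ≤ statDist (hashedSamples Wd hm' ℓ H) (uniformSamples 𝒮 (Fin (t + ξ) → Bool) hm' ℓ) +
        statDist (hashedSamples Wd hm' ℓ H) (uniformSamples 𝒮 (Fin (t + ξ) → Bool) hm' ℓ) := by
        refine add_le_add (statDist_bind_le _ _ _) ?_
        rw [statDist_comm]
        exact statDist_bind_le _ _ _
    _ ≤ ℓ * √((2 : ℝ) ^ (t + ξ) * (2 : ℝ) ^ (-α)) := by
        have hcard : (Fintype.card (Fin (t + ξ) → Bool) : ℝ) = (2 : ℝ) ^ (t + ξ) := by simp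
        rw [hcard] at hdist
        linarith
    _ ≤ σ := hbound

end
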